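/- arXiv:1912.09284 — 4 statements merged into one kernel-verified Lean document; each statement's English description precedes it below -/
import Mathlib

section
/- For all Schwartz functions f, g : ℝ → ℝ, the function ξ := d⁻¹(f)·d⁻¹(g) satisfies ξ′ = d⁻¹(f)·g + f·d⁻¹(g) at every point, and lim_{x→+∞} ξ(x) − lim_{y→−∞} ξ(y) = 0; in particular ∫_ℝ (d⁻¹(f)(x)·g(x) + f(x)·d⁻¹(g)(x)) dx = 0. -/
open MeasureTheory Filter Topology

/-- The operator `d⁻¹` : `d⁻¹(f)(x) = (1/2)(∫_{-∞}^x f − ∫_x^{+∞} f)`. -/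
noncomputable def dInv (f : ℝ → ℝ) (x : ℝ) : ℝ :=
  (1 / 2) * ((∫ z in Set.Iic x, f z) - (∫ z in Set.Ici x, f z))

theorem dInv_eq (f : SchwartzMap ℝ ℝ) (x : ℝ) :
    dInv (fun z => f z) x = (∫ z in (0:ℝ)..x, f z) + (∫ z in Set.Iic (0:ℝ), f z)
      - (1 / 2) * ∫ z, f z := by
  have hi : Integrable (fun z => f z) := f.integrable
  have h1 := intervalIntegral.integral_Iic_add_Ioi (b := x) hi.integrableOn hi.integrableOn
  have h2 := intervalIntegral.integral_Iic_sub_Iic (a := 0) (b := x) hi.integrableOn hi.integrableOn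
  unfold dInv
  rw [integral_Ici_eq_integral_Ioi]
  linarith

theorem dInv_deriv (f : SchwartzMap ℝ ℝ) (x : ℝ) :
    HasDerivAt (dInv (fun z => f z)) (f x) x := by
  have h : dInv (fun z => f z) = fun x => (∫ z in (0:ℝ)..x, f z) + (∫ z in Set.Iic (0:ℝ), f z)
      - (1 / 2) * ∫ z, f z := funext (dInv_eq f)
  rw [h]
  exact ((f.continuous.integral_hasStrictDerivAt 0 x).hasDerivAt.add_const _).sub_const _

theorem dInv_top (f : SchwartzMap ℝ ℝ) :
    Tendsto (dInv (fun z => f z)) atTop (𝓝 ((1 / 2) * ∫ z, f z)) := by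
  have hi : Integrable (fun z => f z) := f.integrable
  have h : dInv (fun z => f z) = fun x => (∫ z in (0:ℝ)..x, f z) + (∫ z in Set.Iic (0:ℝ), f z)
      - (1 / 2) * ∫ z, f z := funext (dInv_eq f)
  have h1 := intervalIntegral.integral_Iic_add_Ioi (b := 0) hi.integrableOn hi.integrableOn
  have h2 := intervalIntegral_tendsto_integral_Ioi 0 hi.integrableOn tendsto_id
  rw [h]
  convert! (h2.add_const _).sub_const _ using 2
  linarith

theorem dInv_bot (f : SchwartzMap ℝ ℝ) :
    Tendsto (dInv (fun z => f z)) atBot (𝓝 (-((1 / 2) * ∫ z, f z))) := by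
  have hi : Integrable (fun z => f z) := f.integrable
  have h : dInv (fun z => f z) = fun x => -(∫ z in x..(0:ℝ), f z) + (∫ z in Set.Iic (0:ℝ), f z)
      - (1 / 2) * ∫ z, f z := by
    funext x
    rw [dInv_eq, intervalIntegral.integral_symm]
  have h2 := intervalIntegral_tendsto_integral_Iic 0 hi.integrableOn tendsto_id
  rw [h]
  convert! (h2.neg.add_const _).sub_const _ using 2
  ring

theorem dInv_bound (f : SchwartzMap ℝ ℝ) (x : ℝ) :
    ‖dInv (fun z => f z) x‖ ≤ ∫ z, ‖f z‖ := by
  have hi : Integrable (fun z => f z) := f.integrable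
  have key : ∀ s : Set ℝ, ‖∫ z in s, f z‖ ≤ ∫ z, ‖f z‖ := fun s =>
    (norm_integral_le_integral_norm _).trans
      (setIntegral_le_integral hi.norm (Eventually.of_forall fun _ => norm_nonneg _))
  have a := key (Set.Iic x)
  have b := key (Set.Ici x)
  have c := norm_sub_le (∫ z in Set.Iic x, f z) (∫ z in Set.Ici x, f z)
  unfold dInv
  rw [norm_mul, show ‖(1 / 2 : ℝ)‖ = 1 / 2 by norm_num]
  linarith

theorem dInv_integrable (f g : SchwartzMap ℝ ℝ) :
    Integrable (fun x => dInv (fun z => f z) x * g x) := by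
  refine Integrable.bdd_mul (c := ∫ z, ‖f z‖) g.integrable ?_
    (Eventually.of_forall (dInv_bound f))
  have : Continuous (dInv (fun z => f z)) :=
    continuous_iff_continuousAt.2 fun x => (dInv_deriv f x).continuousAt
  exact this.aestronglyMeasurable

theorem stmt1 (f g : SchwartzMap ℝ ℝ) :
    (∀ x : ℝ,
      HasDerivAt (fun t => dInv (fun z => f z) t * dInv (fun z => g z) t)
        (dInv (fun z => f z) x * g x + f x * dInv (fun z => g z) x) x) ∧
    (∃ Lp Lm : ℝ,
      Tendsto (fun t => dInv (fun z => f z) t * dInv (fun z => g z) t) atTop (𝓝 Lp) ∧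
      Tendsto (fun t => dInv (fun z => f z) t * dInv (fun z => g z) t) atBot (𝓝 Lm) ∧
      Lp - Lm = 0) ∧
    (∫ x : ℝ, (dInv (fun z => f z) x * g x + f x * dInv (fun z => g z) x)) = 0 := by
  have hd : ∀ x : ℝ,
      HasDerivAt (fun t => dInv (fun z => f z) t * dInv (fun z => g z) t)
        (dInv (fun z => f z) x * g x + f x * dInv (fun z => g z) x) x := by
    intro x
    rw [add_comm]
    exact (dInv_deriv f x).mul (dInv_deriv g x)
  have ht := (dInv_top f).mul (dInv_top g)
  have hb := (dInv_bot f).mul (dInv_bot g)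
  refine ⟨hd, ⟨_, _, ht, hb, by ring⟩, ?_⟩
  rw [integral_of_hasDerivAt_of_tendsto hd ?_ hb ht]
  · ring
  · refine (dInv_integrable f g).add ?_
    simpa only [mul_comm] using dInv_integrable g f
end

section
/- Let 𝔹 ⊂ ℝ^n be a convex open subset. Then for every a, b ∈ 𝔹 there exists a diffeomorphism φ : ℝ^n → ℝ^n such that φ(a) = b and φ(x) = x for every x ∈ ℝ^n ∖ 𝔹. -/
def MovesTo7 (n : ℕ) (B : Set (Fin n → ℝ)) (a b : Fin n → ℝ) : Prop :=
    ∃ φ : (Fin n → ℝ) ≃ (Fin n → ℝ),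
      ContDiff ℝ (⊤ : ℕ∞) φ ∧ ContDiff ℝ (⊤ : ℕ∞) φ.symm ∧ φ a = b ∧ ∀ x ∉ B, φ x = x

theorem perturb7 {E : Type*} [NormedAddCommGroup E] [NormedSpace ℝ E] [CompleteSpace E]
    (g : E → E) (hg : ContDiff ℝ (⊤ : ℕ∞) g) (K : NNReal) (hK : K < 1) (hL : LipschitzWith K g) :
    ∃ φ : E ≃ E, ContDiff ℝ (⊤ : ℕ∞) φ ∧ ContDiff ℝ (⊤ : ℕ∞) φ.symm ∧ ∀ x, φ x = x + g x := by
  rcases subsingleton_or_nontrivial E with hE | hE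
  · exact ⟨Equiv.refl E, contDiff_id, contDiff_id, fun x => Subsingleton.elim _ _⟩
  have hA : ApproximatesLinearOn (fun x => x + g x)
      ((ContinuousLinearEquiv.refl ℝ E : E ≃L[ℝ] E) : E →L[ℝ] E) Set.univ K := by
    intro x _ y _
    have h := hL.dist_le_mul x y
    rw [dist_eq_norm, dist_eq_norm] at h
    have e : (x + g x) - (y + g y) -
      ((ContinuousLinearEquiv.refl ℝ E : E ≃L[ℝ] E) : E →L[ℝ] E) (x - y) = g x - g y := by
      change (x + g x) - (y + g y) - (x - y) = g x - g y
      abel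
    change ‖(x + g x) - (y + g y) -
      ((ContinuousLinearEquiv.refl ℝ E : E ≃L[ℝ] E) : E →L[ℝ] E) (x - y)‖ ≤ _
    rw [e]; exact h
  have hc : Subsingleton E ∨ K < ‖((ContinuousLinearEquiv.refl ℝ E).symm : E →L[ℝ] E)‖₊⁻¹ := by
    right
    have : ‖((ContinuousLinearEquiv.refl ℝ E).symm : E →L[ℝ] E)‖₊ = 1 := by
      apply NNReal.eq
      exact ContinuousLinearMap.norm_id
    rw [this]; simpa using hK
  let Φ : E ≃ₜ E := hA.toHomeomorph _ hc
  have hΦ : ∀ x, Φ x = x + g x := fun x => rfl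
  have hs : ContDiff ℝ (⊤ : ℕ∞) Φ := contDiff_id.add hg
  have hn : ∀ x, ‖-(fderiv ℝ g x)‖ < 1 := fun x => by
    rw [norm_neg]
    exact (norm_fderiv_le_of_lipschitz ℝ hL).trans_lt (by exact_mod_cast hK)
  refine ⟨Φ.toEquiv, hs, ?_, hΦ⟩
  refine Φ.contDiff_symm (f₀' := fun x => ContinuousLinearEquiv.unitsEquiv ℝ E
    (Units.oneSub (-(fderiv ℝ g x)) (hn x))) (fun x => ?_) hs
  have h1 : HasFDerivAt (fun x => x + g x) (ContinuousLinearMap.id ℝ E + fderiv ℝ g x) x :=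
    (hasFDerivAt_id x).add ((hg.differentiable (by simp)) x).hasFDerivAt
  have e : ((ContinuousLinearEquiv.unitsEquiv ℝ E
    (Units.oneSub (-(fderiv ℝ g x)) (hn x)) : E ≃L[ℝ] E) : E →L[ℝ] E)
      = ContinuousLinearMap.id ℝ E + fderiv ℝ g x := by
    ext y
    change (1 - -(fderiv ℝ g x)) y = _
    simp
  rw [e]
  exact h1

theorem local7 (n : ℕ) (B : Set (Fin n → ℝ)) (hBopen : IsOpen B)
    (p : Fin n → ℝ) (hp : p ∈ B) : ∀ᶠ q in nhds p, MovesTo7 n B p q := by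
  obtain ⟨r, hr, hrB⟩ := Metric.isOpen_iff.1 hBopen p hp
  let f : ContDiffBump p := ⟨r / 2, r, by linarith, by linarith⟩
  have hf : ContDiff ℝ (⊤ : ℕ∞) f := f.contDiff
  obtain ⟨C, hC⟩ := hf.lipschitzWith_of_hasCompactSupport f.hasCompactSupport (by simp)
  have ht : Filter.Tendsto (fun q => C * ‖q - p‖₊) (nhds p) (nhds 0) := by
    have : Continuous (fun q => C * ‖q - p‖₊) := by fun_prop
    simpa using this.tendsto p
  filter_upwards [ht.eventually (gt_mem_nhds zero_lt_one)] with q hq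
  have hL : LipschitzWith (C * ‖q - p‖₊) (fun x => f x • (q - p)) := by
    apply LipschitzWith.of_dist_le_mul
    intro x y
    have h := hC.dist_le_mul x y
    rw [dist_eq_norm, ← sub_smul, norm_smul]
    rw [dist_eq_norm] at h
    push_cast
    nlinarith [norm_nonneg (q - p)]
  obtain ⟨φ, h1, h2, h3⟩ := perturb7 (fun x => f x • (q - p)) (hf.smul contDiff_const) _ hq hL
  refine ⟨φ, h1, h2, ?_, fun x hx => ?_⟩
  · have : f p = 1 := f.one_of_mem_closedBall (by simpa using f.rIn_pos.le)
    rw [h3, this]; simp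
  · have : f x = 0 := by
      apply f.zero_of_le_dist
      by_contra h
      exact hx (hrB (by simpa using h))
    rw [h3, this]; simp

/-- Given a convex open `𝔹 ⊆ ℝⁿ` and `a, b ∈ 𝔹`, there is a diffeomorphism of
`ℝⁿ` sending `a` to `b` which is the identity outside `𝔹`. -/
theorem stmt7 (n : ℕ) (B : Set (Fin n → ℝ)) (hBconv : Convex ℝ B) (hBopen : IsOpen B)
    (a b : Fin n → ℝ) (ha : a ∈ B) (hb : b ∈ B) :
    ∃ φ : (Fin n → ℝ) ≃ (Fin n → ℝ),
      ContDiff ℝ (⊤ : ℕ∞) φ ∧ ContDiff ℝ (⊤ : ℕ∞) φ.symm ∧ φ a = b ∧ ∀ x ∉ B, φ x = x := by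
  change MovesTo7 n B a b
  refine hBconv.isPreconnected.induction₂ (MovesTo7 n B) ?_ ?_ ?_ ha hb
  · intro x hx
    exact (local7 n B hBopen x hx).filter_mono nhdsWithin_le_nhds
  · rintro x y z _ _ _ ⟨φ, h1, h2, h3, h4⟩ ⟨ψ, k1, k2, k3, k4⟩
    refine ⟨φ.trans ψ, k1.comp h1, h2.comp k2, by simp [h3, k3], fun w hw => ?_⟩
    simp [h4 w hw, k4 w hw]
  · rintro x y _ _ ⟨φ, h1, h2, h3, h4⟩
    refine ⟨φ.symm, h2, h1, by simp [← h3], fun w hw => ?_⟩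
    rw [Equiv.symm_apply_eq, h4 w hw]
end

section
/- Let φ : ℝ^n → ℝ be a smooth function with φ(0) = 0. Then for every Schwartz function f : ℝ → ℝ^n, the composition φ ∘ f : ℝ → ℝ is a Schwartz function; i.e., the composition operator C_φ(f) := φ ∘ f maps 𝓢_n into 𝓢_1. -/
/-- If `φ : ℝⁿ → ℝ` is smooth with `φ(0) = 0`, composition with `φ` maps
Schwartz functions `ℝ → ℝⁿ` to Schwartz functions `ℝ → ℝ`. -/
theorem stmt11 (n : ℕ) (φ : (Fin n → ℝ) → ℝ) (hφ : ContDiff ℝ (⊤ : ℕ∞) φ) (hφ0 : φ 0 = 0)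
    (f : SchwartzMap ℝ (Fin n → ℝ)) :
    ∃ g : SchwartzMap ℝ ℝ, ∀ x : ℝ, g x = φ (f x) := by
  have hf : ContDiff ℝ (⊤ : ℕ∞) f := f.smooth ⊤
  refine ⟨⟨fun x => φ (f x), hφ.comp hf, ?_⟩, fun x => rfl⟩
  intro k m
  obtain ⟨R, hR⟩ : ∃ R, ∀ x, ‖f x‖ ≤ R := ⟨_, f.norm_le_seminorm ℝ⟩
  have hR0 : 0 ≤ R := (norm_nonneg _).trans (hR 0)
  have hB : ∀ i : ℕ, ∃ C, ∀ y ∈ Metric.closedBall (0 : Fin n → ℝ) R,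
      ‖iteratedFDeriv ℝ i φ y‖ ≤ C := fun i =>
    (isCompact_closedBall _ _).exists_bound_of_continuousOn
      (hφ.continuous_iteratedFDeriv (mod_cast le_top)).continuousOn
  choose B hB using hB
  have hmem : ∀ x, f x ∈ Metric.closedBall (0 : Fin n → ℝ) R := fun x => by simpa using hR x
  rcases Nat.eq_zero_or_pos m with rfl | hm
  · obtain ⟨C, hC⟩ := f.decay' k 0
    refine ⟨B 1 * C, fun x => ?_⟩
    have h1 : ‖φ (f x) - φ 0‖ ≤ B 1 * ‖f x - 0‖ := by
      refine (convex_closedBall (0 : Fin n → ℝ) R).norm_image_sub_le_of_norm_fderiv_le (𝕜 := ℝ)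
        (fun y _ => (hφ.differentiable (by simp)) y) (fun y hy => ?_) (by simpa using hR0) (hmem x)
      rw [← norm_iteratedFDeriv_one]
      exact hB 1 y hy
    have hB0 : 0 ≤ B 1 := (norm_nonneg _).trans (hB 1 _ (hmem 0))
    have h2 := hC x
    simp only [norm_iteratedFDeriv_zero] at h2 ⊢
    rw [hφ0, sub_zero, sub_zero] at h1
    calc ‖x‖ ^ k * ‖φ (f x)‖ ≤ ‖x‖ ^ k * (B 1 * ‖f x‖) := by gcongr
      _ = B 1 * (‖x‖ ^ k * ‖f x‖) := by ring
      _ ≤ B 1 * C := by gcongr; exact h2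
  · obtain ⟨K, hK1, hK⟩ : ∃ K : ℝ, 1 ≤ K ∧ ∀ i ≤ m, ∀ x : ℝ,
        (1 + ‖x‖) ^ (k * m) * ‖iteratedFDeriv ℝ i f x‖ ≤ K := by
      refine ⟨max 1 _, le_max_left _ _, fun i hi x => le_max_of_le_right
        (SchwartzMap.one_add_le_sup_seminorm_apply (𝕜 := ℝ) (m := (k * m, m)) le_rfl hi f x)⟩
    obtain ⟨C, hC⟩ : ∃ C, ∀ i ≤ m, B i ≤ C :=
      ⟨∑ i ∈ Finset.range (m + 1), |B i|, fun i hi => (le_abs_self _).trans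
        (Finset.single_le_sum (f := fun i => |B i|) (fun _ _ => abs_nonneg _)
          (Finset.mem_range.2 (by omega)))⟩
    have hC0 : 0 ≤ C := ((norm_nonneg _).trans (hB m _ (hmem 0))).trans (hC m le_rfl)
    refine ⟨m.factorial * C * K ^ m, fun x => ?_⟩
    have hw : 1 ≤ 1 + ‖x‖ := by simp
    have hw0 : 0 < 1 + ‖x‖ := by positivity
    have key := norm_iteratedFDeriv_comp_le (n := m) hφ hf (mod_cast le_top) x (C := C)
      (D := K / (1 + ‖x‖) ^ k) (fun i hi => (hB i _ (hmem x)).trans (hC i hi))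
      (fun i hi1 him => by
        rw [div_pow, le_div_iff₀ (by positivity), ← pow_mul, mul_comm]
        calc _ ≤ (1 + ‖x‖) ^ (k * m) * ‖iteratedFDeriv ℝ i f x‖ := by gcongr
          _ ≤ K := hK i him x
          _ ≤ K ^ i := le_self_pow₀ hK1 (by omega))
    calc _ ≤ ((1 + ‖x‖) ^ k) ^ m * (m.factorial * C * (K / (1 + ‖x‖) ^ k) ^ m) := by
          refine mul_le_mul ?_ key (norm_nonneg _) (by positivity)
          calc ‖x‖ ^ k ≤ (1 + ‖x‖) ^ k := by gcongr; simp
            _ ≤ _ := le_self_pow₀ (one_le_pow₀ hw) (by omega)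
      _ = m.factorial * C * K ^ m := by
          rw [div_pow]; field_simp
end

section
/- Let φ : ℝ^n → ℝ be a smooth function with φ(0) = 0. Then the composition operator C_φ : 𝓢_n → 𝓢_1 defined by C_φ(f) := φ ∘ f is continuous with respect to the Schwartz space topologies on 𝓢_n and 𝓢_1. -/
theorem aux_bound {E F : Type} [NormedAddCommGroup E] [NormedSpace ℝ E] [ProperSpace E]
    [NormedAddCommGroup F] [NormedSpace ℝ F] (ψ : E → F) (hψ : ContDiff ℝ (⊤ : ℕ∞) ψ)
    (R : ℝ) (k : ℕ) : ∃ B : ℝ, 0 ≤ B ∧ ∀ (g : ℝ → E), ContDiff ℝ (⊤ : ℕ∞) g → ∀ x : ℝ,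
      (∀ i, i ≤ k → ‖iteratedDeriv i g x‖ ≤ R) → ‖iteratedDeriv k (fun y => ψ (g y)) x‖ ≤ B := by
  have h1 : ∀ i : ℕ, ∃ c : ℝ, ∀ u ∈ Metric.closedBall (0 : E) R, ‖iteratedFDeriv ℝ i ψ u‖ ≤ c := by
    intro i
    refine (isCompact_closedBall (0 : E) R).exists_bound_of_continuousOn ?_
    exact (hψ.continuous_iteratedFDeriv (m := i) (by exact_mod_cast le_top)).continuousOn
  choose c hc using h1
  set A : ℝ := ∑ i ∈ Finset.range (k + 1), |c i| with hA
  have hA0 : 0 ≤ A := Finset.sum_nonneg fun i _ => abs_nonneg _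
  refine ⟨k.factorial * A * (max 1 R) ^ k, by positivity, ?_⟩
  intro g hg x hx
  rw [← norm_iteratedFDeriv_eq_norm_iteratedDeriv]
  refine norm_iteratedFDeriv_comp_le (g := ψ) (f := g) hψ hg (n := k)
    (by exact_mod_cast le_top) x ?_ ?_
  · intro i hi
    have hm : g x ∈ Metric.closedBall (0 : E) R := by
      have := hx 0 (Nat.zero_le _)
      simpa using this
    refine (hc i _ hm).trans ((le_abs_self _).trans ?_)
    exact Finset.single_le_sum (f := fun i => |c i|) (fun i _ => abs_nonneg _)
      (Finset.mem_range.2 (by omega))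
  · intro i hi hik
    rw [norm_iteratedFDeriv_eq_norm_iteratedDeriv]
    refine (hx i hik).trans ((le_max_right 1 R).trans ?_)
    exact le_self_pow₀ (le_max_left 1 R) (by omega)

theorem aux_leib {E F : Type} [NormedAddCommGroup E] [NormedSpace ℝ E]
    [NormedAddCommGroup F] [NormedSpace ℝ F] (L : ℝ → E →L[ℝ] F) (g : ℝ → E)
    (hL : ContDiff ℝ (⊤ : ℕ∞) L) (hg : ContDiff ℝ (⊤ : ℕ∞) g) (m : ℕ) (x : ℝ) :
    ‖iteratedDeriv m (fun y => L y (g y)) x‖ ≤ ∑ i ∈ Finset.range (m + 1),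
      (m.choose i : ℝ) * ‖iteratedDeriv i L x‖ * ‖iteratedDeriv (m - i) g x‖ := by
  simp only [← norm_iteratedFDeriv_eq_norm_iteratedDeriv]
  exact norm_iteratedFDeriv_clm_apply hL hg x (by exact_mod_cast le_top)

theorem aux_diff {E : Type} [NormedAddCommGroup E] [NormedSpace ℝ E] [ProperSpace E] (R : ℝ)
    (k : ℕ) : ∀ (F : Type) [NormedAddCommGroup F] [NormedSpace ℝ F] (φ : E → F),
      ContDiff ℝ (⊤ : ℕ∞) φ → ∃ K : ℝ, 0 ≤ K ∧ ∀ (f g : ℝ → E), ContDiff ℝ (⊤ : ℕ∞) f →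
      ContDiff ℝ (⊤ : ℕ∞) g → ∀ x : ℝ, (∀ i, i ≤ k → ‖iteratedDeriv i f x‖ ≤ R) →
      (∀ i, i ≤ k → ‖iteratedDeriv i g x‖ ≤ R) →
      ‖iteratedDeriv k (fun y => φ (f y) - φ (g y)) x‖ ≤
        K * ∑ i ∈ Finset.range (k + 1), ‖iteratedDeriv i (fun y => f y - g y) x‖ := by
  induction k using Nat.strong_induction_on with
  | _ k ih =>
  intro F _ _ φ hφ
  have hφ' : ContDiff ℝ (⊤ : ℕ∞) (fderiv ℝ φ) := hφ.fderiv_right (by simp)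
  have hφd : Differentiable ℝ φ := hφ.differentiable (by simp)
  rcases k with _ | m
  · obtain ⟨c, hc⟩ := (isCompact_closedBall (0 : E) R).exists_bound_of_continuousOn
      hφ'.continuous.continuousOn
    refine ⟨|c|, abs_nonneg c, ?_⟩
    intro f g hf hg x hfx hgx
    have hf0 : f x ∈ Metric.closedBall (0 : E) R := by simpa using hfx 0 le_rfl
    have hg0 : g x ∈ Metric.closedBall (0 : E) R := by simpa using hgx 0 le_rfl
    simpa using (convex_closedBall (0 : E) R).norm_image_sub_le_of_norm_fderiv_le (𝕜 := ℝ)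
      (f := φ) (C := |c|)
      (fun u _ => hφd u) (fun u hu => (hc u hu).trans (le_abs_self c)) hg0 hf0
  · have h1 : ∀ j : ℕ, ∃ K : ℝ, 0 ≤ K ∧ (j ≤ m → ∀ (f g : ℝ → E), ContDiff ℝ (⊤ : ℕ∞) f →
      ContDiff ℝ (⊤ : ℕ∞) g → ∀ x : ℝ, (∀ i, i ≤ j → ‖iteratedDeriv i f x‖ ≤ R) →
      (∀ i, i ≤ j → ‖iteratedDeriv i g x‖ ≤ R) →
      ‖iteratedDeriv j (fun y => fderiv ℝ φ (f y) - fderiv ℝ φ (g y)) x‖ ≤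
        K * ∑ i ∈ Finset.range (j + 1), ‖iteratedDeriv i (fun y => f y - g y) x‖) := by
      intro j
      by_cases hj : j ≤ m
      · obtain ⟨K, hK, h⟩ := ih j (by omega) _ (fderiv ℝ φ) hφ'
        exact ⟨K, hK, fun _ => h⟩
      · exact ⟨0, le_rfl, fun h => absurd h hj⟩
    choose K hK0 hK using h1
    choose B hB0 hB using fun j => aux_bound (fderiv ℝ φ) hφ' R j
    refine ⟨∑ j ∈ Finset.range (m + 1), (m.choose j : ℝ) * (K j * |R| + B j),
      Finset.sum_nonneg fun j _ => ?_, ?_⟩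
    · have := hK0 j
      have := hB0 j
      positivity
    intro f g hf hg x hfx hgx
    have hfd : Differentiable ℝ f := hf.differentiable (by simp)
    have hgd : Differentiable ℝ g := hg.differentiable (by simp)
    have hf' : ContDiff ℝ (⊤ : ℕ∞) (deriv f) := (contDiff_infty_iff_deriv.1 hf).2
    have hg' : ContDiff ℝ (⊤ : ℕ∞) (deriv g) := (contDiff_infty_iff_deriv.1 hg).2
    have hpf : ContDiff ℝ (⊤ : ℕ∞) (fun y => fderiv ℝ φ (f y)) := hφ'.comp hf
    have hpg : ContDiff ℝ (⊤ : ℕ∞) (fun y => fderiv ℝ φ (g y)) := hφ'.comp hg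
    set S : ℝ := ∑ i ∈ Finset.range (m + 1 + 1), ‖iteratedDeriv i (fun y => f y - g y) x‖ with hS
    have hder : deriv (fun y => φ (f y) - φ (g y)) =
        (fun y => (fderiv ℝ φ (f y) - fderiv ℝ φ (g y)) (deriv f y)) +
        (fun y => fderiv ℝ φ (g y) (deriv f y - deriv g y)) := by
      funext y
      have e1 : HasDerivAt (fun y => φ (f y)) (fderiv ℝ φ (f y) (deriv f y)) y :=
        (hφd (f y)).hasFDerivAt.comp_hasDerivAt y (hfd y).hasDerivAt
      have e2 : HasDerivAt (fun y => φ (g y)) (fderiv ℝ φ (g y) (deriv g y)) y :=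
        (hφd (g y)).hasFDerivAt.comp_hasDerivAt y (hgd y).hasDerivAt
      rw [(e1.fun_sub e2).deriv]
      simp
    have hdd : (fun y => deriv f y - deriv g y) = deriv (fun y => f y - g y) := by
      funext y
      rw [deriv_fun_sub (hfd y) (hgd y)]
    have hc1 : ContDiff ℝ (⊤ : ℕ∞) (fun y => (fderiv ℝ φ (f y) - fderiv ℝ φ (g y)) (deriv f y)) :=
      (hpf.sub hpg).clm_apply hf'
    have hc2 : ContDiff ℝ (⊤ : ℕ∞) (fun y => fderiv ℝ φ (g y) (deriv f y - deriv g y)) :=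
      hpg.clm_apply (hf'.sub hg')
    have hmt : ((m : ℕ∞) : WithTop ℕ∞) ≤ ((⊤ : ℕ∞) : WithTop ℕ∞) := by exact_mod_cast le_top
    rw [iteratedDeriv_succ', hder,
      iteratedDeriv_add (hc1.of_le hmt).contDiffAt (hc2.of_le hmt).contDiffAt]
    refine (norm_add_le _ _).trans ?_
    refine (add_le_add (aux_leib _ _ (hpf.sub hpg) hf' m x)
      (aux_leib _ _ hpg (hf'.sub hg') m x)).trans ?_
    rw [← Finset.sum_add_distrib, Finset.sum_mul]
    refine Finset.sum_le_sum fun j hj => ?_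
    have hjm : j ≤ m := by
      have := Finset.mem_range.1 hj
      omega
    have b1 : ‖iteratedDeriv j (fun y => fderiv ℝ φ (f y) - fderiv ℝ φ (g y)) x‖ ≤ K j * S := by
      refine (hK j hjm f g hf hg x (fun i hi => hfx i (by omega))
        (fun i hi => hgx i (by omega))).trans ?_
      refine mul_le_mul_of_nonneg_left ?_ (hK0 j)
      refine Finset.sum_le_sum_of_subset_of_nonneg ?_ (fun _ _ _ => norm_nonneg _)
      intro i hi
      have := Finset.mem_range.1 hi
      exact Finset.mem_range.2 (by omega)
    have b2 : ‖iteratedDeriv (m - j) (deriv f) x‖ ≤ |R| := by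
      rw [← iteratedDeriv_succ']
      exact (hfx _ (by omega)).trans (le_abs_self R)
    have b3 : ‖iteratedDeriv j (fun y => fderiv ℝ φ (g y)) x‖ ≤ B j :=
      hB j g hg x (fun i hi => hgx i (by omega))
    have b4 : ‖iteratedDeriv (m - j) (fun y => deriv f y - deriv g y) x‖ ≤ S := by
      rw [hdd, ← iteratedDeriv_succ']
      exact Finset.single_le_sum (f := fun i => ‖iteratedDeriv i (fun y => f y - g y) x‖)
        (fun i _ => norm_nonneg _) (Finset.mem_range.2 (by omega))
    have hS0 : 0 ≤ S := Finset.sum_nonneg fun _ _ => norm_nonneg _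
    have hKj := hK0 j
    have hBj := hB0 j
    calc _ ≤ (m.choose j : ℝ) * (K j * S) * |R| + (m.choose j : ℝ) * B j * S := by
          gcongr
      _ = _ := by ring

/-- If `φ : ℝⁿ → ℝ` is smooth with `φ(0) = 0`, the composition operator
`C_φ : 𝓢_n → 𝓢_1`, `C_φ(f) := φ ∘ f`, is continuous for the Schwartz
topologies. -/
theorem stmt12 (n : ℕ) (φ : (Fin n → ℝ) → ℝ) (hφ : ContDiff ℝ (⊤ : ℕ∞) φ) (hφ0 : φ 0 = 0)
    (C : SchwartzMap ℝ (Fin n → ℝ) → SchwartzMap ℝ ℝ)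
    (hC : ∀ (f : SchwartzMap ℝ (Fin n → ℝ)) (x : ℝ), C f x = φ (f x)) :
    Continuous C := by
  rw [continuous_iff_continuousAt]
  intro g
  unfold ContinuousAt
  rw [(schwartz_withSeminorms ℝ ℝ ℝ).tendsto_nhds]
  rintro ⟨p, k⟩ ε hε
  have hE := ((schwartz_withSeminorms ℝ ℝ (Fin n → ℝ)).tendsto_nhds id g).1 Filter.tendsto_id
  set R : ℝ := ∑ i ∈ Finset.range (k + 1), (SchwartzMap.seminorm ℝ 0 i g) + 1 with hR
  obtain ⟨K, hK0, hK⟩ := aux_diff (E := Fin n → ℝ) R k ℝ φ hφ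
  set δ : ℝ := ε / (2 * (K + 1) * (k + 1)) with hδ
  have hδ0 : 0 < δ := by positivity
  have h1 : ∀ᶠ f in nhds g, ∀ i ∈ Finset.range (k + 1), SchwartzMap.seminorm ℝ 0 i (f - g) < 1 :=
    (Finset.eventually_all _).2 fun i _ => hE (0, i) 1 one_pos
  have h2 : ∀ᶠ f in nhds g, ∀ i ∈ Finset.range (k + 1), SchwartzMap.seminorm ℝ p i (f - g) < δ :=
    (Finset.eventually_all _).2 fun i _ => hE (p, i) δ hδ0
  filter_upwards [h1, h2] with f hf1 hf2
  have hgR : ∀ i ≤ k, SchwartzMap.seminorm ℝ 0 i g + 1 ≤ R := by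
    intro i hi
    rw [hR]
    gcongr
    exact Finset.single_le_sum (f := fun i => SchwartzMap.seminorm ℝ 0 i g)
      (fun i _ => apply_nonneg _ _) (Finset.mem_range.2 (by omega))
  have hle : ∀ (h : SchwartzMap ℝ (Fin n → ℝ)) (i : ℕ) (x : ℝ),
      ‖iteratedDeriv i h x‖ ≤ SchwartzMap.seminorm ℝ 0 i h := by
    intro h i x
    simpa using SchwartzMap.le_seminorm' ℝ 0 i h x
  have key : SchwartzMap.seminorm ℝ p k (C f - C g) ≤ K * ((k + 1) * δ) := by
    refine SchwartzMap.seminorm_le_bound' ℝ p k _ (by positivity) fun x => ?_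
    have e : (⇑(C f - C g) : ℝ → ℝ) = fun y => φ (f y) - φ (g y) := by
      funext y
      simp [hC]
    have e' : (fun y => f y - g y) = ⇑(f - g) := by
      funext y
      simp
    have := hK f g (f.smooth _) (g.smooth _) x ?_ ?_
    · rw [e]
      calc _ ≤ |x| ^ p * (K * ∑ i ∈ Finset.range (k + 1),
              ‖iteratedDeriv i (fun y => f y - g y) x‖) := by gcongr
        _ = K * ∑ i ∈ Finset.range (k + 1),
              |x| ^ p * ‖iteratedDeriv i (fun y => f y - g y) x‖ := by
            rw [← Finset.mul_sum]; ring
        _ ≤ K * ∑ i ∈ Finset.range (k + 1), δ := by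
            gcongr with i hi
            rw [e']
            exact (SchwartzMap.le_seminorm' ℝ p i (f - g) x).trans (hf2 i hi).le
        _ = _ := by simp
    · intro i hi
      refine (hle f i x).trans (le_trans ?_ (hgR i hi))
      have t := map_add_le_add (SchwartzMap.seminorm ℝ 0 i) (f - g) g
      rw [sub_add_cancel] at t
      have := hf1 i (Finset.mem_range.2 (by omega))
      linarith
    · intro i hi
      have := hgR i hi
      linarith [hle g i x]
  refine lt_of_le_of_lt key ?_
  have : K * ((k + 1) * δ) = ε * (K / (2 * (K + 1))) := by
    rw [hδ]
    field_simp
  rw [this]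
  have : K / (2 * (K + 1)) < 1 := by
    rw [div_lt_one (by positivity)]
    linarith
  nlinarith
end
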